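/- Every nontrivial root-closed Puiseux monoid is either atomic or antimatter. -/

import Mathlib

/-- A Puiseux monoid: an additive submonoid of `ℚ` all of whose elements are nonnegative. -/
def IsPuiseuxMonoid (M : AddSubmonoid ℚ) : Prop := ∀ x ∈ M, 0 ≤ x

/-- A Puiseux monoid `M` is root-closed if every `x ∈ ℚ` lying in the difference group of `M`
with `n • x ∈ M` for some positive integer `n` belongs to `M`. -/
def IsRootClosedPM (M : AddSubmonoid ℚ) : Prop :=
  ∀ x : ℚ, (∃ a ∈ M, ∃ b ∈ M, x = a - b) → (∃ n : ℕ, 0 < n ∧ (n : ℚ) * x ∈ M) → x ∈ M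

/-- `a` is an atom of the Puiseux monoid `M`. -/
def IsAtomOf (M : AddSubmonoid ℚ) (a : ℚ) : Prop :=
  a ∈ M ∧ a ≠ 0 ∧ ∀ x ∈ M, ∀ y ∈ M, a = x + y → x = 0 ∨ y = 0

/-- A Puiseux monoid is atomic if every element is a finite sum of atoms. -/
def IsAtomicPM (M : AddSubmonoid ℚ) : Prop :=
  ∀ x ∈ M, ∃ s : Multiset ℚ, (∀ a ∈ s, IsAtomOf M a) ∧ s.sum = x

/-- A Puiseux monoid is antimatter if it has no atoms. -/
def IsAntimatterPM (M : AddSubmonoid ℚ) : Prop := ¬ ∃ a : ℚ, IsAtomOf M a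

/-- A root-closed Puiseux monoid is closed under nonnegative differences. -/
theorem IsRootClosedPM.sub_mem {M : AddSubmonoid ℚ} (hM : IsPuiseuxMonoid M)
    (hrc : IsRootClosedPM M) {a b : ℚ} (ha : a ∈ M) (hb : b ∈ M) (hba : b ≤ a) :
    a - b ∈ M := by
  rcases (hM a ha).eq_or_lt with h0 | hpos
  · have hb0 : b = 0 := le_antisymm (h0 ▸ hba) (hM b hb)
    simpa [hb0] using ha
  · refine hrc _ ⟨a, ha, b, hb, rfl⟩ ⟨(a - b).den * a.num.toNat, ?_, ?_⟩
    · have := Rat.num_pos.mpr hpos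
      exact Nat.mul_pos (a - b).den_pos (by omega)
    · have hmem := M.nsmul_mem ha ((a - b).num.toNat * a.den)
      have hnum : ∀ q : ℚ, 0 ≤ q → (q.num.toNat : ℚ) = q.den * q := fun q hq => by
        rw [Rat.den_mul_eq_num]
        exact_mod_cast Int.toNat_of_nonneg (Rat.num_nonneg.mpr hq)
      rw [nsmul_eq_mul] at hmem
      push_cast at hmem ⊢
      rw [hnum _ hpos.le]
      rw [hnum _ (sub_nonneg.mpr hba)] at hmem
      convert hmem using 1
      ring

/-- In a root-closed Puiseux monoid, every element is a multiple of any given atom. -/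
theorem IsAtomOf.exists_nsmul_eq {M : AddSubmonoid ℚ} (hM : IsPuiseuxMonoid M)
    (hrc : IsRootClosedPM M) {a x : ℚ} (ha : IsAtomOf M a) (hx : x ∈ M) :
    ∃ k : ℕ, k • a = x := by
  obtain ⟨haM, ha0, hirr⟩ := ha
  have hpos : 0 < a := (hM a haM).lt_of_ne' ha0
  have hle : ⌊x / a⌋₊ • a ≤ x := by
    rw [nsmul_eq_mul, ← le_div_iff₀ hpos]
    exact Nat.floor_le (div_nonneg (hM x hx) hpos.le)
  have hlt : x - ⌊x / a⌋₊ • a < a := by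
    have h := Nat.lt_floor_add_one (x / a)
    rw [div_lt_iff₀ hpos] at h
    rw [nsmul_eq_mul]
    linarith
  have hr := hrc.sub_mem hM hx (M.nsmul_mem haM ⌊x / a⌋₊) hle
  refine ⟨⌊x / a⌋₊, ?_⟩
  rcases hirr _ hr _ (hrc.sub_mem hM haM hr hlt.le) (by ring) with h | h <;> linarith

/-- Every nontrivial root-closed Puiseux monoid is either atomic or antimatter. -/
theorem rootClosed_atomic_or_antimatter (M : AddSubmonoid ℚ) (hM : IsPuiseuxMonoid M)
    (hMnt : M ≠ ⊥) (hrc : IsRootClosedPM M) :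
    IsAtomicPM M ∨ IsAntimatterPM M := by
  by_cases h : ∃ a, IsAtomOf M a
  · obtain ⟨a, ha⟩ := h
    refine Or.inl fun x hx => ?_
    obtain ⟨k, hk⟩ := ha.exists_nsmul_eq hM hrc hx
    refine ⟨Multiset.replicate k a, fun b hb => ?_, by rw [Multiset.sum_replicate, hk]⟩
    rwa [Multiset.eq_of_mem_replicate hb]
  · exact Or.inr h
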